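/- Let α be irrational, Tx = x + α, and φ : 𝕋 → S¹ be a continuous function that is Lipschitz and has non-zero topological degree d ≠ 0. Writing χ_A∘φ for A ∈ ℤ, A ≠ 0: the function e^{2πi A d x}·(φ(x)^A · e^{−2πi A d x}) has degree Ad ≠ 0; conclude that φ^A is not a multiplicative T-coboundary, i.e., there is no measurable ξ : 𝕋 → S¹ with φ(x)^A = ξ(x)/ξ(x+α) a.e. -/

import Mathlib

open MeasureTheory

lemma aux_shift {E : Type*} [NormedAddCommGroup E] [NormedSpace ℝ E] (u : ℝ → E)
    (hu : Function.Periodic u 1) (s : ℝ) :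
    ∫ x in (0:ℝ)..1, u (x + s) = ∫ x in (0:ℝ)..1, u x := by
  rw [intervalIntegral.integral_comp_add_right]
  have := hu.intervalIntegral_add_eq s 0
  simpa [add_comm] using this

lemma aux_approx (u : ℝ → ℂ) (hu : Measurable u) (M : ℝ) (hM : ∀ x, ‖u x‖ ≤ M)
    (ε : ℝ) (hε : 0 < ε) :
    ∃ P ∈ Submodule.span ℂ (Set.range (@fourier 1)),
      ∫ x in (0:ℝ)..1, ‖u x - P (x : UnitAddCircle)‖ ≤ ε := by
  set U : UnitAddCircle → ℂ := AddCircle.liftIoc 1 0 u with hU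
  have hUm : Measurable U :=
    (hu.comp measurable_subtype_coe).comp (AddCircle.measurableEquivIoc 1 0).measurable
  have hUb : ∀ x, ‖U x‖ ≤ M := fun x => hM _
  have hUi : Integrable U volume :=
    Integrable.of_bound hUm.aestronglyMeasurable M (Filter.Eventually.of_forall hUb)
  obtain ⟨g, hg, hgi⟩ := hUi.exists_boundedContinuous_integral_sub_le (half_pos hε)
  have hmem : g.toContinuousMap ∈ (Submodule.span ℂ (Set.range (@fourier 1))).topologicalClosure := by
    rw [span_fourier_closure_eq_top]; trivial
  rw [← SetLike.mem_coe, Submodule.topologicalClosure_coe, Metric.mem_closure_iff] at hmem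
  obtain ⟨P, hP, hd⟩ := hmem (ε/2) (half_pos hε)
  refine ⟨P, hP, ?_⟩
  have hPi : Integrable (fun x => P x) (volume : Measure UnitAddCircle) :=
    P.continuous.integrable_of_hasCompactSupport (HasCompactSupport.of_compactSpace _)
  have h1 : ∫ x in (0:ℝ)..1, ‖u x - P (x : UnitAddCircle)‖ = ∫ x, ‖U x - P x‖ := by
    rw [← UnitAddCircle.intervalIntegral_preimage 0, zero_add]
    apply intervalIntegral.integral_congr_ae
    refine Filter.Eventually.of_forall fun x hx => ?_
    rw [Set.uIoc_of_le zero_le_one] at hx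
    rw [hU, AddCircle.liftIoc_coe_apply (by simpa using hx)]
  rw [h1]
  calc ∫ x, ‖U x - P x‖ ≤ ∫ x, (‖U x - g x‖ + ε/2) := by
        apply integral_mono (hUi.sub hPi).norm ((hUi.sub hgi).norm.add (integrable_const _))
        intro x
        have h2 : ‖g x - P x‖ ≤ ε/2 := by
          rw [← dist_eq_norm]
          exact (ContinuousMap.dist_apply_le_dist (f := g.toContinuousMap) (g := P) x).trans hd.le
        have := norm_sub_le_norm_sub_add_norm_sub (U x) (g x) (P x)
        change ‖U x - P x‖ ≤ ‖U x - g x‖ + ε/2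
        linarith
    _ = (∫ x, ‖U x - g x‖) + ε/2 := by
        have h5 := integral_add (hUi.sub hgi).norm (integrable_const (μ := volume) (ε/2))
        simp only [Pi.sub_apply] at h5
        rw [h5]; simp [Measure.real]
    _ ≤ ε := by linarith

lemma aux_sum (α : ℝ) (hα : Irrational α) (P : C(UnitAddCircle, ℂ))
    (hP : P ∈ Submodule.span ℂ (Set.range (@fourier 1))) :
    ∃ C : ℝ, ∀ (n : ℕ) (x : UnitAddCircle),
      ‖∑ j ∈ Finset.range n, P (x + ((j * α : ℝ) : UnitAddCircle)) - n * ∫ y, P y‖ ≤ C := by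
  have hint : ∀ P : C(UnitAddCircle, ℂ), Integrable (fun x => P x) (volume : Measure UnitAddCircle) :=
    fun P => P.continuous.integrable_of_hasCompactSupport (HasCompactSupport.of_compactSpace _)
  induction hP using Submodule.span_induction with
  | mem P h =>
    obtain ⟨k, rfl⟩ := h
    by_cases hk : k = 0
    · subst hk
      refine ⟨0, fun n x => ?_⟩
      simp [Measure.real]
    set w : ℂ := fourier k (α : UnitAddCircle) with hw
    have hw1 : w ≠ 1 := by
      rw [hw, fourier_coe_apply]
      intro h
      rw [Complex.exp_eq_one_iff] at h
      obtain ⟨m, hm⟩ := h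
      have h2 : (k : ℂ) * α = m := by
        have : (2 * Real.pi * Complex.I : ℂ) ≠ 0 := Complex.two_pi_I_ne_zero
        apply mul_left_cancel₀ this
        simp at hm
        rw [← mul_assoc, hm, mul_comm]
      have h3 : (k : ℝ) * α = m := by exact_mod_cast h2
      exact (hα.intCast_mul hk).ne_int m h3
    have hadd : ∀ x y : UnitAddCircle, fourier k (x + y) = fourier k x * fourier k y := by
      intro x y
      simp [fourier_apply, AddCircle.toCircle_add]
    have hpow : ∀ j : ℕ, fourier k (((j * α : ℝ)) : UnitAddCircle) = w ^ j := by
      intro j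
      induction j with
      | zero => simp
      | succ j ih =>
        rw [pow_succ, ← ih, hw, ← hadd, ← AddCircle.coe_add]
        push_cast
        rw [add_mul, one_mul]
    have hzero : ∫ y : UnitAddCircle, fourier k y = 0 := by
      have h1 := integral_add_right_eq_self (μ := (volume : Measure UnitAddCircle))
        (fun y => fourier k y) (α : UnitAddCircle)
      simp only [hadd] at h1
      rw [integral_mul_const] at h1
      by_contra h0
      exact hw1 (mul_left_cancel₀ h0 (by rw [h1, mul_one]))
    have hwn : ‖w‖ = 1 := by rw [hw, fourier_apply]; exact Circle.norm_coe _
    refine ⟨2 / ‖w - 1‖, fun n x => ?_⟩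
    rw [hzero, mul_zero, sub_zero]
    simp only [hadd, hpow]
    rw [← Finset.mul_sum, norm_mul, geom_sum_eq hw1, norm_div]
    have : ‖fourier k x‖ = 1 := by rw [fourier_apply]; exact Circle.norm_coe _
    rw [this, one_mul]
    gcongr
    refine (norm_sub_le _ _).trans ?_
    rw [norm_pow, hwn]; norm_num
  | zero => exact ⟨0, fun n x => by simp⟩
  | add P Q _ _ hP hQ =>
    obtain ⟨C, hC⟩ := hP
    obtain ⟨D, hD⟩ := hQ
    refine ⟨C + D, fun n x => ?_⟩
    simp only [ContinuousMap.add_apply]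
    rw [integral_add (hint P) (hint Q), Finset.sum_add_distrib, mul_add, add_sub_add_comm]
    exact (norm_add_le _ _).trans (add_le_add (hC n x) (hD n x))
  | smul c P _ hP =>
    obtain ⟨C, hC⟩ := hP
    refine ⟨‖c‖ * C, fun n x => ?_⟩
    simp only [ContinuousMap.smul_apply, smul_eq_mul]
    rw [integral_const_mul, ← Finset.mul_sum, mul_left_comm, ← mul_sub, norm_mul]
    gcongr
    exact hC n x

lemma aux_rec (α δ : ℝ) (hδ : 0 < δ) (M : ℕ) (hM : 0 < M) :
    ∃ n : ℕ, M ≤ n ∧ ‖((n * α : ℝ) : UnitAddCircle)‖ ≤ δ := by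
  obtain ⟨N, hN⟩ := exists_nat_gt (M / δ)
  have hN0 : (0:ℝ) < N := lt_trans (by positivity) hN
  obtain ⟨j, hj, hj2⟩ := AddCircle.exists_norm_nsmul_le (T := 1) (α : UnitAddCircle) (n := N)
    (by exact_mod_cast hN0)
  refine ⟨M * j, Nat.le_mul_of_pos_right _ hj.1, ?_⟩
  have : (((M * j : ℕ) * α : ℝ) : UnitAddCircle) = M • (j • (α : UnitAddCircle)) := by
    rw [← AddCircle.coe_nsmul, ← AddCircle.coe_nsmul]
    simp [mul_assoc]
  rw [this]
  refine norm_nsmul_le.trans ?_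
  rw [div_lt_iff₀ hδ] at hN
  have h3 : (1:ℝ) / ((N+1 : ℕ) : ℝ) ≤ δ / M := by
    rw [div_le_div_iff₀ (by positivity) (by positivity)]
    push_cast
    nlinarith
  calc (M:ℝ) * _ ≤ M * (δ / M) := by gcongr; exact hj2.trans h3
    _ = δ := by field_simp

lemma aux_ftc (θ : ℝ → ℝ) (K : NNReal) (hθ : LipschitzWith K θ) (k : ℤ)
    (h : θ 1 = θ 0 + k * (2 * Real.pi)) (θ' : ℝ → ℝ) (hd : ∀ᵐ x, HasDerivAt θ (θ' x) x) :
    ∫ x in (0:ℝ)..1, Real.cos (θ x) * θ' x = 0 := by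
  have hs : LipschitzWith (1 * K) (fun x => Real.sin (θ x)) :=
    (Real.lipschitzWith_sin).comp hθ
  have := (hs.lipschitzOnWith (s := Set.uIcc 0 1)).absolutelyContinuousOnInterval.integral_deriv_eq_sub
  rw [h, Real.sin_add_int_mul_two_pi, sub_self] at this
  refine Eq.trans ?_ this
  apply intervalIntegral.integral_congr_ae
  filter_upwards [hd] with x hx _
  exact (hx.sin.deriv).symm

lemma aux_ii {E : Type*} [NormedAddCommGroup E] (u : ℝ → E)
    (hu : AEStronglyMeasurable u volume) (M : ℝ) (hM : ∀ x, ‖u x‖ ≤ M) (a b : ℝ) :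
    IntervalIntegrable u volume a b := by
  rw [intervalIntegrable_iff]
  exact Measure.integrableOn_of_bounded (M := M) (by simp) hu (Filter.Eventually.of_forall hM)

lemma aux_bound (P : C(UnitAddCircle, ℂ)) (x : ℝ) : ‖P (x : UnitAddCircle)‖ ≤ ‖P‖ :=
  P.norm_coe_le_norm _

lemma aux_iiP (u : ℝ → ℂ) (hu : Measurable u) (M : ℝ) (hM : ∀ x, ‖u x‖ ≤ M)
    (P : C(UnitAddCircle, ℂ)) (s a b : ℝ) :
    IntervalIntegrable (fun x => ‖u (x + s) - P ((x + s : ℝ) : UnitAddCircle)‖) volume a b := by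
  have hc : Continuous fun x : ℝ => P ((x + s : ℝ) : UnitAddCircle) := by
    exact P.continuous.comp ((AddCircle.continuous_mk' 1).comp (continuous_add_const s))
  apply IntervalIntegrable.norm
  apply aux_ii _ _ (M + ‖P‖) _
  · exact ((hu.comp (measurable_id.add_const s)).sub hc.measurable).aestronglyMeasurable
  · intro x
    exact (norm_sub_le _ _).trans (add_le_add (hM _) (aux_bound P _))

lemma aux_per (u : ℝ → ℂ) (hu : Function.Periodic u 1) (P : C(UnitAddCircle, ℂ)) :
    Function.Periodic (fun x => ‖u x - P (x : UnitAddCircle)‖) 1 := by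
  intro x
  simp only [hu x, AddCircle.coe_add_period]

lemma aux_trans (ξ : ℝ → ℂ) (hm : Measurable ξ) (h1 : ∀ x, ‖ξ x‖ = 1)
    (hp : Function.Periodic ξ 1) (ε : ℝ) (hε : 0 < ε) :
    ∃ δ > 0, ∀ s : ℝ, ‖(s : UnitAddCircle)‖ ≤ δ →
      ∫ x in (0:ℝ)..1, ‖ξ x - ξ (x + s)‖ ≤ ε := by
  obtain ⟨P, -, hP⟩ := aux_approx ξ hm 1 (fun x => (h1 x).le) (ε/3) (by positivity)
  have huc := CompactSpace.uniformContinuous_of_continuous P.continuous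
  rw [Metric.uniformContinuous_iff] at huc
  obtain ⟨δ, hδ, hδ2⟩ := huc (ε/3) (by positivity)
  refine ⟨δ/2, by positivity, fun s hs => ?_⟩
  have hi0 := aux_iiP ξ hm 1 (fun x => (h1 x).le) P 0 0 1
  simp only [add_zero] at hi0
  have his := aux_iiP ξ hm 1 (fun x => (h1 x).le) P s 0 1
  have hi : IntervalIntegrable (fun x => ‖ξ x - ξ (x + s)‖) volume 0 1 := by
    apply IntervalIntegrable.norm
    apply aux_ii _ (hm.sub (hm.comp (measurable_id.add_const s))).aestronglyMeasurable 2
    intro x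
    refine (norm_sub_le _ _).trans ?_
    simp only [Function.comp, h1]; norm_num
  calc ∫ x in (0:ℝ)..1, ‖ξ x - ξ (x + s)‖
      ≤ ∫ x in (0:ℝ)..1, ((‖ξ x - P (x : UnitAddCircle)‖ + ε/3) +
          ‖ξ (x + s) - P ((x + s : ℝ) : UnitAddCircle)‖) := by
        apply intervalIntegral.integral_mono_on zero_le_one hi
          ((hi0.add intervalIntegrable_const).add his)
        intro x _
        have h3 : ‖P (x : UnitAddCircle) - P ((x + s : ℝ) : UnitAddCircle)‖ ≤ ε/3 := by
          rw [← dist_eq_norm]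
          apply (hδ2 _).le
          rw [dist_eq_norm, ← norm_neg]
          have : -((x : UnitAddCircle) - ((x + s : ℝ) : UnitAddCircle)) = (s : UnitAddCircle) := by
            rw [AddCircle.coe_add]; abel
          rw [this]; linarith
        have h4 := norm_sub_le_norm_sub_add_norm_sub (ξ x) (P (x : UnitAddCircle)) (ξ (x+s))
        have h5 := norm_sub_le_norm_sub_add_norm_sub (P (x : UnitAddCircle))
          (P ((x + s : ℝ) : UnitAddCircle)) (ξ (x+s))
        rw [norm_sub_rev (P ((x + s : ℝ) : UnitAddCircle))] at h5
        linarith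
    _ = (∫ x in (0:ℝ)..1, ‖ξ x - P (x : UnitAddCircle)‖) + ε/3 +
        ∫ x in (0:ℝ)..1, ‖ξ x - P (x : UnitAddCircle)‖ := by
        rw [intervalIntegral.integral_add (hi0.add intervalIntegrable_const) his,
          intervalIntegral.integral_add hi0 intervalIntegrable_const,
          aux_shift _ (aux_per ξ hp P) s]
        simp
    _ ≤ ε := by linarith

lemma aux_erg (α : ℝ) (hα : Irrational α) (h : ℝ → ℝ) (hm : Measurable h) (M : ℝ)
    (hM : ∀ x, ‖h x‖ ≤ M) (hp : Function.Periodic h 1) (h0 : ∫ x in (0:ℝ)..1, h x = 0)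
    (ε : ℝ) (hε : 0 < ε) :
    ∃ C : ℝ, ∀ n : ℕ, ∫ x in (0:ℝ)..1, |∑ j ∈ Finset.range n, h (x + j * α)| ≤ C + n * ε := by
  set u : ℝ → ℂ := fun x => (h x : ℂ) with hu
  have hum : Measurable u := Complex.measurable_ofReal.comp hm
  have huM : ∀ x, ‖u x‖ ≤ M := fun x => by rw [hu, Complex.norm_real]; exact hM x
  have hup : Function.Periodic u 1 := fun x => by simp only [hu, hp x]
  obtain ⟨P, hPs, hP⟩ := aux_approx u hum M huM (ε/2) (by positivity)
  obtain ⟨C, hC⟩ := aux_sum α hα P hPs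
  have hint : ‖∫ y, P y‖ ≤ ε/2 := by
    rw [← UnitAddCircle.intervalIntegral_preimage 0, zero_add]
    have hc : Continuous fun x : ℝ => P (x : UnitAddCircle) :=
      P.continuous.comp (AddCircle.continuous_mk' 1)
    have : ∫ x in (0:ℝ)..1, P (x : UnitAddCircle)
        = - ∫ x in (0:ℝ)..1, (u x - P (x : UnitAddCircle)) := by
      rw [intervalIntegral.integral_sub (aux_ii u hum.aestronglyMeasurable M huM 0 1)
        (hc.intervalIntegrable 0 1)]
      have h6 : ∫ x in (0:ℝ)..1, u x = 0 := by
        rw [hu, intervalIntegral.integral_ofReal, h0, Complex.ofReal_zero]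
      rw [h6]; simp
    rw [this, norm_neg]
    exact (intervalIntegral.norm_integral_le_integral_norm zero_le_one).trans hP
  refine ⟨C, fun n => ?_⟩
  have hi : ∀ j ∈ Finset.range n, IntervalIntegrable
      (fun x => ‖u (x + j * α) - P ((x + j * α : ℝ) : UnitAddCircle)‖) volume 0 1 :=
    fun j _ => aux_iiP u hum M huM P (j * α) 0 1
  have hi1 : IntervalIntegrable (fun x => |∑ j ∈ Finset.range n, h (x + j * α)|) volume 0 1 := by
    apply IntervalIntegrable.abs
    have : IntervalIntegrable (∑ j ∈ Finset.range n, fun x => h (x + j * α)) volume 0 1 := by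
      apply IntervalIntegrable.sum
      intro j _
      exact aux_ii _ (hm.comp (measurable_id.add_const _)).aestronglyMeasurable M (fun x => hM _) 0 1
    have heq : (fun x => ∑ j ∈ Finset.range n, h (x + j * α)) =
        ∑ j ∈ Finset.range n, fun x => h (x + j * α) := by
      ext x; simp
    rw [heq]
    exact this
  have hi2 : IntervalIntegrable (fun x => ∑ j ∈ Finset.range n,
      ‖u (x + j * α) - P ((x + j * α : ℝ) : UnitAddCircle)‖) volume 0 1 := by
    have := IntervalIntegrable.sum _ hi
    have heq : (fun x => ∑ j ∈ Finset.range n,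
        ‖u (x + j * α) - P ((x + j * α : ℝ) : UnitAddCircle)‖) = ∑ j ∈ Finset.range n,
        (fun x => ‖u (x + j * α) - P ((x + j * α : ℝ) : UnitAddCircle)‖) := by
      ext x; simp
    rw [heq]
    exact this
  calc ∫ x in (0:ℝ)..1, |∑ j ∈ Finset.range n, h (x + j * α)|
      ≤ ∫ x in (0:ℝ)..1, (∑ j ∈ Finset.range n,
          ‖u (x + j * α) - P ((x + j * α : ℝ) : UnitAddCircle)‖ + (C + n * (ε/2))) := by
        apply intervalIntegral.integral_mono_on zero_le_one hi1
          (hi2.add intervalIntegrable_const)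
        intro x _
        have e1 : |∑ j ∈ Finset.range n, h (x + j * α)|
            = ‖∑ j ∈ Finset.range n, u (x + j * α)‖ := by
          rw [← Real.norm_eq_abs, ← Complex.norm_real]
          simp [hu]
        have e2 : ∑ j ∈ Finset.range n, u (x + j * α)
            = ∑ j ∈ Finset.range n, (u (x + j * α) - P ((x + j * α : ℝ) : UnitAddCircle))
              + (∑ j ∈ Finset.range n, P ((x : UnitAddCircle) + ((j * α : ℝ) : UnitAddCircle))
                - n * ∫ y, P y) + n * ∫ y, P y := by
          simp only [AddCircle.coe_add, Finset.sum_sub_distrib]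
          ring
        rw [e1, e2]
        refine (norm_add₃_le).trans ?_
        have e3 := norm_sum_le (Finset.range n)
          (fun j : ℕ => u (x + j * α) - P ((x + j * α : ℝ) : UnitAddCircle))
        have e4 := hC n x
        have e5 : ‖(n : ℂ) * ∫ y, P y‖ ≤ n * (ε/2) := by
          rw [norm_mul, Complex.norm_natCast]; gcongr
        linarith
    _ = ∑ j ∈ Finset.range n, (∫ x in (0:ℝ)..1, ‖u x - P (x : UnitAddCircle)‖)
          + (C + n * (ε/2)) := by
        rw [intervalIntegral.integral_add hi2 intervalIntegrable_const,
          intervalIntegral.integral_finsetSum hi]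
        congr 1
        · apply Finset.sum_congr rfl
          intro j _
          exact aux_shift _ (aux_per u hup P) (j * α)
        · simp
    _ ≤ C + n * ε := by
        rw [Finset.sum_const, Finset.card_range, nsmul_eq_mul]
        have : (n:ℝ) * (∫ x in (0:ℝ)..1, ‖u x - P (x : UnitAddCircle)‖) ≤ n * (ε/2) := by gcongr
        linarith

/-- A Lipschitz circle-valued cocycle `φ(x) = e^{2πi(dx+f(x))}` of non-zero topological
degree `d` over an irrational rotation is such that no non-zero power `φ^A` is a
multiplicative coboundary: there is no measurable unimodular `1`-periodic
`ξ : ℝ → ℂ` with `φ(x)^A = ξ(x)/ξ(x+α)` almost everywhere. -/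
theorem stmt19 (α : ℝ) (hα : Irrational α) (d : ℤ) (hd : d ≠ 0)
    (f : ℝ → ℝ) (hfper : ∀ x, f (x + 1) = f x) (hfLip : ∃ K : NNReal, LipschitzWith K f)
    (A : ℤ) (hA : A ≠ 0) :
    ¬ ∃ ξ : ℝ → ℂ, Measurable ξ ∧ (∀ x, ‖ξ x‖ = 1) ∧ (∀ x, ξ (x + 1) = ξ x) ∧
      ∀ᵐ x ∂(volume : Measure ℝ),
        Complex.exp (2 * Real.pi * Complex.I * (A : ℂ) * (((d : ℝ) * x + f x : ℝ) : ℂ))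
          = ξ x / ξ (x + α) := by
  rintro ⟨ξ, hm, h1, hp, hae⟩
  obtain ⟨K, hK⟩ := hfLip
  set h : ℝ → ℝ := deriv f with hh
  have hhm : Measurable h := measurable_deriv f
  have hhM : ∀ x, ‖h x‖ ≤ K := fun x => norm_deriv_le_of_lipschitz hK
  have hhp : Function.Periodic h 1 := by
    intro x
    have : (fun x => f (x + 1)) = f := funext hfper
    rw [hh, ← deriv_comp_add_const, this]
  have hh0 : ∫ x in (0:ℝ)..1, h x = 0 := by
    have := (hK.lipschitzOnWith (s := Set.uIcc 0 1)).absolutelyContinuousOnInterval.integral_deriv_eq_sub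
    rw [hh, this]
    have := hfper 0
    rw [zero_add] at this
    rw [this, sub_self]
  obtain ⟨C, hC⟩ := aux_erg α hα h hhm K hhM hhp hh0 (1/4) (by norm_num)
  obtain ⟨δ, hδ, hδ2⟩ := aux_trans ξ hm h1 hp (1/4) (by norm_num)
  obtain ⟨M, hM⟩ := exists_nat_gt (4 * C)
  obtain ⟨n, hn, hnδ⟩ := aux_rec α δ hδ (M+1) (Nat.succ_pos _)
  have hn1 : (M:ℝ) + 1 ≤ n := by exact_mod_cast hn
  have hM0 : (0:ℝ) ≤ M := Nat.cast_nonneg _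
  -- the phase
  let ψ : ℝ → ℝ := fun x => d * x + f x
  let θ : ℕ → ℝ → ℝ := fun n x => 2 * Real.pi * A * ∑ j ∈ Finset.range n, ψ (x + j * α)
  have hF : ∀ n : ℕ, ∀ᵐ x, Complex.exp (θ n x * Complex.I) = ξ x / ξ (x + n * α) := by
    intro n
    induction n with
    | zero =>
      refine Filter.Eventually.of_forall fun x => ?_
      have : ξ x ≠ 0 := by intro h; have := h1 x; simp [h] at this
      simp [θ, this]
    | succ n ih =>
      have hae2 := (measurePreserving_add_right (volume : Measure ℝ) (n * α)).quasiMeasurePreserving.ae hae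
      filter_upwards [ih, hae2] with x hx hx2
      have e : ((θ (n+1) x : ℝ) : ℂ) * Complex.I = θ n x * Complex.I +
          2 * Real.pi * Complex.I * (A : ℂ) * (((d : ℝ) * (x + n * α) + f (x + n * α) : ℝ) : ℂ) := by
        simp only [θ, Finset.sum_range_succ, ψ]
        push_cast
        ring
      rw [e, Complex.exp_add, hx, hx2]
      have : ξ (x + n * α) ≠ 0 := by intro h; have := h1 (x + n * α); simp [h] at this
      rw [div_mul_div_cancel₀ this]
      push_cast
      congr 2; ring
  have hψL : ∃ L, LipschitzWith L ψ := by
    refine ⟨_, (LipschitzWith.of_dist_le_mul (K := Real.nnabs (d:ℝ)) (f := fun x : ℝ => (d:ℝ) * x) ?_).add hK⟩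
    intro x y
    rw [Real.dist_eq, Real.dist_eq, ← mul_sub, abs_mul]; rfl
  have hθL : ∃ L, LipschitzWith L (θ n) := by
    obtain ⟨L, hL⟩ := hψL
    have hS : ∀ n : ℕ, ∃ L, LipschitzWith L (fun x => ∑ j ∈ Finset.range n, ψ (x + j * α)) := by
      intro n
      induction n with
      | zero => exact ⟨0, by simpa using LipschitzWith.const (0:ℝ)⟩
      | succ n ih =>
        obtain ⟨L', hL'⟩ := ih
        simp only [Finset.sum_range_succ]
        refine ⟨_, hL'.add (hL.comp (LipschitzWith.of_dist_le_mul (K := 1) (f := fun x : ℝ => x + n * α) ?_))⟩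
        intro x y
        simp
    obtain ⟨L', hL'⟩ := hS n
    refine ⟨Real.nnabs (2 * Real.pi * A) * L', LipschitzWith.of_dist_le_mul fun x y => ?_⟩
    have := hL'.dist_le_mul x y
    rw [Real.dist_eq] at this ⊢
    simp only [θ]
    rw [← mul_sub, abs_mul, NNReal.coe_mul, Real.coe_nnabs, mul_assoc |2 * Real.pi * (A:ℝ)|]
    exact mul_le_mul_of_nonneg_left this (abs_nonneg _)
  obtain ⟨L, hL⟩ := hθL
  have hθ1 : θ n 1 = θ n 0 + ((A * (n * d) : ℤ) : ℝ) * (2 * Real.pi) := by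
    have : ∀ j : ℕ, ψ (1 + j * α) = ψ (0 + j * α) + d := by
      intro j
      simp only [ψ]
      rw [add_comm (1:ℝ) (j * α), hfper, zero_add]; ring
    simp only [θ, this, Finset.sum_add_distrib, Finset.sum_const, Finset.card_range, nsmul_eq_mul]
    push_cast; ring
  have hθd : ∀ᵐ x, HasDerivAt (θ n)
      (2 * Real.pi * A * (n * d + ∑ j ∈ Finset.range n, h (x + j * α))) x := by
    have hall : ∀ᵐ x, ∀ j : ℕ, DifferentiableAt ℝ f (x + j * α) := by
      rw [ae_all_iff]
      intro j
      exact (measurePreserving_add_right (volume : Measure ℝ) (j * α)).quasiMeasurePreserving.ae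
        hK.ae_differentiableAt_real
    filter_upwards [hall] with x hx
    have h2 : ∀ j ∈ Finset.range n, HasDerivAt (fun x => ψ (x + j * α)) (d + h (x + j * α)) x := by
      intro j _
      have h3 : HasDerivAt ψ (d + h (x + j * α)) (x + j * α) := by
        have := ((hasDerivAt_id (x + j * α)).const_mul (d:ℝ)).add (hx j).hasDerivAt
        rw [mul_one] at this
        exact this
      exact h3.comp_add_const x (j * α)
    have h3 := (HasDerivAt.fun_sum h2).const_mul (2 * Real.pi * A)
    rw [Finset.sum_add_distrib, Finset.sum_const, Finset.card_range, nsmul_eq_mul] at h3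
    exact h3
  have hftc := aux_ftc (θ n) L hL _ hθ1 _ hθd
  have hcosc : Continuous fun x => Real.cos (θ n x) := Real.continuous_cos.comp hL.continuous
  set S : ℝ → ℝ := fun x => ∑ j ∈ Finset.range n, h (x + j * α) with hS
  have hSm : Measurable S := by
    apply Finset.measurable_fun_sum
    intro j _
    exact hhm.comp (measurable_id.add_const _)
  have hSb : ∀ x, ‖S x‖ ≤ n * K := by
    intro x
    refine (norm_sum_le _ _).trans ?_
    refine (Finset.sum_le_sum fun j _ => hhM _).trans ?_
    simp
  have hSi : IntervalIntegrable S volume 0 1 := aux_ii S hSm.aestronglyMeasurable _ hSb 0 1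
  have hcSi : IntervalIntegrable (fun x => Real.cos (θ n x) * S x) volume 0 1 :=
    hSi.continuousOn_mul hcosc.continuousOn
  have hkey : (n * d : ℝ) * ∫ x in (0:ℝ)..1, Real.cos (θ n x)
      = - ∫ x in (0:ℝ)..1, Real.cos (θ n x) * S x := by
    have e : ∀ x, Real.cos (θ n x) * (2 * Real.pi * A * (n * d + S x))
        = 2 * Real.pi * A * (n * d * Real.cos (θ n x) + Real.cos (θ n x) * S x) := by
      intro x; ring
    have hftc : ∫ x in (0:ℝ)..1, 2 * Real.pi * A *
        (n * d * Real.cos (θ n x) + Real.cos (θ n x) * S x) = 0 := by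
      refine Eq.trans ?_ hftc
      exact intervalIntegral.integral_congr fun x _ => (e x).symm
    rw [intervalIntegral.integral_const_mul, intervalIntegral.integral_add
      ((hcosc.intervalIntegrable 0 1).const_mul _) hcSi,
      intervalIntegral.integral_const_mul] at hftc
    have hne : 2 * Real.pi * (A:ℝ) ≠ 0 := by
      have : (A:ℝ) ≠ 0 := by exact_mod_cast hA
      have := Real.pi_ne_zero
      positivity
    have := (mul_eq_zero.mp hftc).resolve_left hne
    linarith
  have hup : |∫ x in (0:ℝ)..1, Real.cos (θ n x) * S x| ≤ C + n * (1/4) := by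
    refine (intervalIntegral.abs_integral_le_integral_abs zero_le_one).trans ?_
    refine le_trans ?_ (hC n)
    apply intervalIntegral.integral_mono_on zero_le_one hcSi.abs hSi.abs
    intro x _
    rw [abs_mul]
    exact mul_le_of_le_one_left (abs_nonneg _) (Real.abs_cos_le_one _)
  have hlow : 3/4 ≤ ∫ x in (0:ℝ)..1, Real.cos (θ n x) := by
    have hi : IntervalIntegrable (fun x => ‖ξ x - ξ (x + n * α)‖) volume 0 1 := by
      apply IntervalIntegrable.norm
      apply aux_ii _ (hm.sub (hm.comp (measurable_id.add_const (n * α)))).aestronglyMeasurable 2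
      intro x
      refine (norm_sub_le _ _).trans ?_
      simp only [Function.comp, h1]; norm_num
    have h2 := hδ2 (n * α) hnδ
    have h3 : ∫ x in (0:ℝ)..1, (1 - Real.cos (θ n x)) ≤ ∫ x in (0:ℝ)..1, ‖ξ x - ξ (x + n * α)‖ := by
      apply intervalIntegral.integral_mono_ae zero_le_one
        (intervalIntegrable_const.sub (hcosc.intervalIntegrable 0 1)) hi
      filter_upwards [hF n] with x hx
      have hne : ξ (x + n * α) ≠ 0 := by intro h; have := h1 (x + n * α); simp [h] at this
      have e1 : ξ x - ξ (x + n * α) = (Complex.exp (θ n x * Complex.I) - 1) * ξ (x + n * α) := by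
        rw [hx]; field_simp
      rw [e1, norm_mul, h1, mul_one, norm_sub_rev]
      have := Complex.re_le_norm (1 - Complex.exp (θ n x * Complex.I))
      rwa [Complex.sub_re, Complex.one_re, Complex.exp_ofReal_mul_I_re] at this
    rw [intervalIntegral.integral_sub intervalIntegrable_const (hcosc.intervalIntegrable 0 1)] at h3
    simp at h3
    linarith
  have hd1 : (1:ℝ) ≤ |(d:ℝ)| := by exact_mod_cast Int.one_le_abs hd
  have hfin : (n:ℝ) * (3/4) ≤ C + n * (1/4) := by
    refine le_trans ?_ hup
    rw [← abs_neg, ← hkey, abs_mul, abs_mul, Nat.abs_cast]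
    have h5 := le_abs_self (∫ x in (0:ℝ)..1, Real.cos (θ n x))
    calc (n:ℝ) * (3/4) = n * 1 * (3/4) := by ring
      _ ≤ _ := by gcongr; linarith
  linarith
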